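/- For every real σ > 0, ∫₀^σ 𝓘₁(x) dx = (πσ/2)·[H₁⁽¹⁾(σ)·𝐇₀(σ) − H₀⁽¹⁾(σ)·𝐇₁(σ)] + (2σ/π)·i. -/

import Mathlib

open MeasureTheory Set Filter Topology Real intervalIntegral

/-- Bessel function of the first kind `J_n(x)` (integral representation). -/
noncomputable def besselJ (n : ℕ) (x : ℝ) : ℝ :=
  (1 / π) * ∫ τ in (0:ℝ)..π, Real.cos (n * τ - x * Real.sin τ)

/-- Bessel function of the second kind `Y_n(x)` (integral representation). -/
noncomputable def besselY (n : ℕ) (x : ℝ) : ℝ :=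
  (1 / π) * (∫ τ in (0:ℝ)..π, Real.sin (x * Real.sin τ - n * τ))
    - (1 / π) * ∫ t in Set.Ioi (0:ℝ),
        (Real.exp (n * t) + (-1 : ℝ) ^ n * Real.exp (-(n * t))) * Real.exp (-x * Real.sinh t)

/-- Hankel function of the first kind `H_n^{(1)}(x) = J_n(x) + i Y_n(x)`. -/
noncomputable def hankelH1 (n : ℕ) (x : ℝ) : ℂ :=
  (besselJ n x : ℂ) + Complex.I * (besselY n x : ℂ)

/-- Struve function `𝐇₀(x)`. -/
noncomputable def struveH0 (x : ℝ) : ℝ :=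
  (2 / π) * ∫ t in (0:ℝ)..1, Real.sin (x * t) / Real.sqrt (1 - t ^ 2)

/-- Struve function `𝐇₁(x)`. -/
noncomputable def struveH1 (x : ℝ) : ℝ :=
  (2 * x / π) * ∫ t in (0:ℝ)..1, Real.sqrt (1 - t ^ 2) * Real.sin (x * t)

/-- Struve function `𝐇₋₁(x) = 2/π − 𝐇₁(x)`. -/
noncomputable def struveHm1 (x : ℝ) : ℝ := 2 / π - struveH1 x

/-- `𝓘₁(u) = ∫₀^u x·H₀⁽¹⁾(x) dx`. -/
noncomputable def calI1 (u : ℝ) : ℂ := ∫ x in (0:ℝ)..u, (x : ℂ) * hankelH1 0 x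


noncomputable def cc (k : ℕ) (x : ℝ) : ℝ := ∫ τ in (0:ℝ)..π, Real.sin τ ^ k * Real.cos (x * Real.sin τ)
noncomputable def ss (k : ℕ) (x : ℝ) : ℝ := ∫ τ in (0:ℝ)..π, Real.sin τ ^ k * Real.sin (x * Real.sin τ)
noncomputable def qq (k : ℕ) (x : ℝ) : ℝ :=
  ∫ t in Set.Ioi (0:ℝ), Real.sinh t ^ k * Real.exp (-x * Real.sinh t)

lemma sin_pow_abs_le (k : ℕ) (τ y : ℝ) (hy : |y| ≤ 1) : ‖Real.sin τ ^ k * y‖ ≤ 1 := by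
  rw [Real.norm_eq_abs, abs_mul, abs_pow]
  exact mul_le_one₀ (pow_le_one₀ (abs_nonneg _) (Real.abs_sin_le_one τ)) (abs_nonneg _) hy

lemma hasDerivAt_cc (k : ℕ) (x : ℝ) : HasDerivAt (cc k) (-ss (k+1) x) x := by
  have h := (intervalIntegral.hasDerivAt_integral_of_dominated_loc_of_deriv_le (μ := volume)
    (a := 0) (b := π) (x₀ := x) (s := univ) (bound := fun _ => 1)
    (F := fun x τ => Real.sin τ ^ k * Real.cos (x * Real.sin τ))
    (F' := fun x τ => Real.sin τ ^ (k+1) * (-Real.sin (x * Real.sin τ))) univ_mem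
    (Eventually.of_forall fun y => Continuous.aestronglyMeasurable (by fun_prop))
    (Continuous.intervalIntegrable (by fun_prop) _ _)
    (Continuous.aestronglyMeasurable (by fun_prop))
    (Eventually.of_forall fun t _ y _ => sin_pow_abs_le _ _ _ (by
      rw [abs_neg]; exact Real.abs_sin_le_one _))
    (by simp)
    (Eventually.of_forall fun t _ y _ => by
      have := (((hasDerivAt_id y).mul_const (Real.sin t)).cos).const_mul (Real.sin t ^ k)
      refine this.congr_deriv ?_
      simp; ring)).2
  refine h.congr_deriv ?_
  simp [ss]

lemma hasDerivAt_ss (k : ℕ) (x : ℝ) : HasDerivAt (ss k) (cc (k+1) x) x := by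
  have h := (intervalIntegral.hasDerivAt_integral_of_dominated_loc_of_deriv_le (μ := volume)
    (a := 0) (b := π) (x₀ := x) (s := univ) (bound := fun _ => 1)
    (F := fun x τ => Real.sin τ ^ k * Real.sin (x * Real.sin τ))
    (F' := fun x τ => Real.sin τ ^ (k+1) * (Real.cos (x * Real.sin τ))) univ_mem
    (Eventually.of_forall fun y => Continuous.aestronglyMeasurable (by fun_prop))
    (Continuous.intervalIntegrable (by fun_prop) _ _)
    (Continuous.aestronglyMeasurable (by fun_prop))
    (Eventually.of_forall fun t _ y _ => sin_pow_abs_le _ _ _ (Real.abs_cos_le_one _))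
    (by simp)
    (Eventually.of_forall fun t _ y _ => by
      have := (((hasDerivAt_id y).mul_const (Real.sin t)).sin).const_mul (Real.sin t ^ k)
      refine this.congr_deriv ?_
      simp; ring)).2
  exact h

lemma cc_rel (x : ℝ) : x * (cc 0 x - cc 2 x) = ss 1 x := by
  have h : ∫ τ in (0:ℝ)..π, (x * (Real.sin τ ^ 0 * Real.cos (x * Real.sin τ)
      - Real.sin τ ^ 2 * Real.cos (x * Real.sin τ)) - Real.sin τ ^ 1 * Real.sin (x * Real.sin τ)) = 0 := by
    rw [intervalIntegral.integral_eq_sub_of_hasDerivAt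
      (f := fun τ => Real.cos τ * Real.sin (x * Real.sin τ))]
    · simp
    · intro τ _
      refine ((Real.hasDerivAt_cos τ).mul (((Real.hasDerivAt_sin τ).const_mul x).sin)).congr_deriv ?_
      have := Real.sin_sq_add_cos_sq τ
      have h2 : Real.sin τ ^ 2 = 1 - Real.cos τ ^ 2 := by linarith
      rw [h2]; ring
    · exact Continuous.intervalIntegrable (by fun_prop) _ _
  rw [intervalIntegral.integral_sub, intervalIntegral.integral_const_mul,
    intervalIntegral.integral_sub] at h
  · simp only [cc, ss]; linarith
  all_goals exact Continuous.intervalIntegrable (by fun_prop) _ _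

lemma ss_rel (x : ℝ) : x * (ss 0 x - ss 2 x) = 2 - cc 1 x := by
  have h : ∫ τ in (0:ℝ)..π, (x * (Real.sin τ ^ 0 * Real.sin (x * Real.sin τ)
      - Real.sin τ ^ 2 * Real.sin (x * Real.sin τ)) + Real.sin τ ^ 1 * Real.cos (x * Real.sin τ)) = 2 := by
    rw [intervalIntegral.integral_eq_sub_of_hasDerivAt
      (f := fun τ => - (Real.cos τ * Real.cos (x * Real.sin τ)))]
    · simp; norm_num
    · intro τ _
      refine ((Real.hasDerivAt_cos τ).mul (((Real.hasDerivAt_sin τ).const_mul x).cos)).neg.congr_deriv ?_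
      have := Real.sin_sq_add_cos_sq τ
      have h2 : Real.sin τ ^ 2 = 1 - Real.cos τ ^ 2 := by linarith
      rw [h2]; ring
    · exact Continuous.intervalIntegrable (by fun_prop) _ _
  rw [intervalIntegral.integral_add, intervalIntegral.integral_const_mul,
    intervalIntegral.integral_sub] at h
  · simp only [cc, ss]; linarith
  all_goals exact Continuous.intervalIntegrable (by fun_prop) _ _

lemma sinh_bound (k : ℕ) {c t : ℝ} (hc : 0 < c) (ht : 0 ≤ t) :
    Real.sinh t ^ k * Real.exp (-c * Real.sinh t)
      ≤ ((2 / c) ^ k * k.factorial) * Real.exp (-(c/2) * t) := by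
  have hs : 0 ≤ Real.sinh t := Real.sinh_nonneg_iff.2 ht
  have h1 := Real.pow_div_factorial_le_exp (c / 2 * Real.sinh t) (by positivity) k
  have hk : (0:ℝ) < k.factorial := by positivity
  rw [div_le_iff₀ hk] at h1
  have h2 : Real.sinh t ^ k = (2 / c) ^ k * (c / 2 * Real.sinh t) ^ k := by
    rw [← mul_pow]; congr 1; field_simp
  have h3 : t ≤ Real.sinh t := Real.self_le_sinh_iff.2 ht
  calc _ ≤ ((2 / c) ^ k * (Real.exp (c / 2 * Real.sinh t) * k.factorial)) * Real.exp (-c * Real.sinh t) := by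
        rw [h2]; gcongr
    _ = ((2 / c) ^ k * k.factorial) * Real.exp (-(c/2) * Real.sinh t) := by
        have : Real.exp (-(c/2) * Real.sinh t) = Real.exp (c / 2 * Real.sinh t) * Real.exp (-c * Real.sinh t) := by
          rw [← Real.exp_add]; congr 1; ring
        rw [this]; ring
    _ ≤ _ := by
        gcongr ?_ * Real.exp ?_
        nlinarith

lemma integrable_qq (k : ℕ) {c : ℝ} (hc : 0 < c) :
    IntegrableOn (fun t => Real.sinh t ^ k * Real.exp (-c * Real.sinh t)) (Ioi 0) := by
  refine Integrable.mono' (g := fun t => ((2 / c) ^ k * k.factorial) * Real.exp (-(c/2) * t))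
    ((exp_neg_integrableOn_Ioi 0 (by positivity)).const_mul _)
    (Continuous.aestronglyMeasurable (by fun_prop)) ?_
  refine (ae_restrict_iff' measurableSet_Ioi).2 (Eventually.of_forall fun t ht => ?_)
  have hs : 0 ≤ Real.sinh t := Real.sinh_nonneg_iff.2 (le_of_lt ht)
  rw [Real.norm_of_nonneg (by positivity)]
  exact sinh_bound k hc (le_of_lt ht)

lemma hasDerivAt_qq (k : ℕ) {x : ℝ} (hx : 0 < x) : HasDerivAt (qq k) (-qq (k+1) x) x := by
  have h := (hasDerivAt_integral_of_dominated_loc_of_deriv_le (μ := volume.restrict (Ioi (0:ℝ)))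
    (x₀ := x) (s := Ioi (x/2))
    (bound := fun t => Real.sinh t ^ (k+1) * Real.exp (-(x/2) * Real.sinh t))
    (F := fun x t => Real.sinh t ^ k * Real.exp (-x * Real.sinh t))
    (F' := fun x t => -(Real.sinh t ^ (k+1) * Real.exp (-x * Real.sinh t)))
    (Ioi_mem_nhds (by linarith))
    (Eventually.of_forall fun y => Continuous.aestronglyMeasurable (by fun_prop))
    (integrable_qq k hx)
    (Continuous.aestronglyMeasurable (by fun_prop))
    ((ae_restrict_iff' measurableSet_Ioi).2 (Eventually.of_forall fun t ht y hy => by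
      have hs : 0 ≤ Real.sinh t := Real.sinh_nonneg_iff.2 (le_of_lt ht)
      rw [norm_neg, Real.norm_of_nonneg (by positivity)]
      have : x / 2 < y := hy
      gcongr))
    (integrable_qq (k+1) (by positivity))
    (Eventually.of_forall fun t y _ => by
      have := ((((hasDerivAt_id y).neg).mul_const (Real.sinh t)).exp).const_mul (Real.sinh t ^ k)
      refine this.congr_deriv ?_
      simp; ring)).2
  refine h.congr_deriv ?_
  rw [MeasureTheory.integral_neg, qq]

lemma cosh_tendsto {x : ℝ} (hx : 0 < x) :
    Tendsto (fun t => Real.cosh t * Real.exp (-x * Real.sinh t)) atTop (𝓝 0) := by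
  have hE : Tendsto (fun t : ℝ => Real.exp (-(x/2) * t)) atTop (𝓝 0) := by
    apply Real.tendsto_exp_atBot.comp
    exact tendsto_id.const_mul_atTop_of_neg (by linarith)
  have hlim : Tendsto (fun t : ℝ => (((2 / x) ^ 0 * (Nat.factorial 0 : ℝ)) * Real.exp (-(x/2) * t)) +
    ((2 / x) ^ 1 * (Nat.factorial 1 : ℝ)) * Real.exp (-(x/2) * t)) atTop (𝓝 0) := by
    have := (hE.const_mul ((2 / x) ^ 0 * (Nat.factorial 0 : ℝ))).add
      (hE.const_mul ((2 / x) ^ 1 * (Nat.factorial 1 : ℝ)))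
    rwa [mul_zero, mul_zero, add_zero] at this
  refine squeeze_zero' (Eventually.of_forall fun t => by positivity) ?_ hlim
  filter_upwards [eventually_ge_atTop 0] with t ht
  have h0 := sinh_bound 0 hx ht
  have h1 := sinh_bound 1 hx ht
  have : Real.cosh t ≤ Real.sinh t ^ 0 + Real.sinh t ^ 1 := by
    have := Real.cosh_sub_sinh t
    have : Real.exp (-t) ≤ 1 := Real.exp_le_one_iff.2 (by linarith)
    simp; linarith
  calc _ ≤ (Real.sinh t ^ 0 + Real.sinh t ^ 1) * Real.exp (-x * Real.sinh t) := by gcongr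
    _ ≤ _ := by rw [add_mul]; linarith

lemma qq_rel {x : ℝ} (hx : 0 < x) : x * (qq 0 x + qq 2 x) = 1 + qq 1 x := by
  have i0 := integrable_qq 0 hx
  have i1 := integrable_qq 1 hx
  have i2 := integrable_qq 2 hx
  have i3 : IntegrableOn (fun t => x * (Real.sinh t ^ 0 * Real.exp (-x * Real.sinh t)
      + Real.sinh t ^ 2 * Real.exp (-x * Real.sinh t))) (Ioi 0) := (i0.add i2).const_mul x
  have h := integral_Ioi_of_hasDerivAt_of_tendsto' (a := 0)
    (f := fun t => Real.cosh t * Real.exp (-x * Real.sinh t))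
    (f' := fun t => Real.sinh t ^ 1 * Real.exp (-x * Real.sinh t)
      - x * (Real.sinh t ^ 0 * Real.exp (-x * Real.sinh t) + Real.sinh t ^ 2 * Real.exp (-x * Real.sinh t)))
    (fun t _ => by
      refine ((Real.hasDerivAt_cosh t).mul (((Real.hasDerivAt_sinh t).const_mul (-x)).exp)).congr_deriv ?_
      have h2 : Real.sinh t ^ 2 = Real.cosh t ^ 2 - 1 := by rw [Real.cosh_sq]; ring
      rw [h2]; ring)
    (i1.sub i3) (cosh_tendsto hx)
  rw [MeasureTheory.integral_sub i1 i3, MeasureTheory.integral_const_mul,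
    MeasureTheory.integral_add i0 i2] at h
  simp only [Real.cosh_zero, Real.sinh_zero, mul_zero, Real.exp_zero, mul_one] at h
  simp only [qq]; linarith

/-- `x q₁(x) → 1`. -/
lemma qq_one_bound {x : ℝ} (hx : 0 < x) : |x * qq 1 x - 1| ≤ x := by
  have i1 := integrable_qq 1 hx
  have ie : IntegrableOn (fun t => Real.exp (-t) * Real.exp (-x * Real.sinh t)) (Ioi 0) := by
    refine Integrable.mono' (integrableOn_exp_neg_Ioi 0)
      (Continuous.aestronglyMeasurable (by fun_prop)) ?_
    refine (ae_restrict_iff' measurableSet_Ioi).2 (Eventually.of_forall fun t ht => ?_)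
    have hs : 0 ≤ Real.sinh t := Real.sinh_nonneg_iff.2 (le_of_lt ht)
    rw [Real.norm_of_nonneg (by positivity)]
    have : Real.exp (-x * Real.sinh t) ≤ 1 := Real.exp_le_one_iff.2 (by nlinarith)
    exact mul_le_of_le_one_right (by positivity) this
  have i3 : IntegrableOn (fun t => x * (Real.sinh t ^ 1 * Real.exp (-x * Real.sinh t)
      + (Real.exp (-t) * Real.exp (-x * Real.sinh t)))) (Ioi 0) := (i1.add ie).const_mul x
  have hE : Tendsto (fun t : ℝ => -Real.exp (-x * Real.sinh t)) atTop (𝓝 0) := by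
    rw [← neg_zero]
    refine Tendsto.neg ?_
    refine squeeze_zero' (Eventually.of_forall fun t => by positivity) ?_ (cosh_tendsto hx)
    refine Eventually.of_forall fun t => ?_
    exact le_mul_of_one_le_left (by positivity) (Real.one_le_cosh t)
  have h := integral_Ioi_of_hasDerivAt_of_tendsto' (a := 0)
    (f := fun t => -Real.exp (-x * Real.sinh t))
    (f' := fun t => x * (Real.sinh t ^ 1 * Real.exp (-x * Real.sinh t)
      + (Real.exp (-t) * Real.exp (-x * Real.sinh t))))
    (fun t _ => by
      refine ((((Real.hasDerivAt_sinh t).const_mul (-x)).exp)).neg.congr_deriv ?_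
      rw [← Real.cosh_sub_sinh t]; ring)
    i3 hE
  rw [MeasureTheory.integral_const_mul, MeasureTheory.integral_add i1 ie] at h
  simp only [Real.sinh_zero, mul_zero, Real.exp_zero] at h
  have hb1 : ∫ t in Ioi (0:ℝ), Real.exp (-t) * Real.exp (-x * Real.sinh t) ≤ 1 := by
    rw [← integral_exp_neg_Ioi_zero]
    refine setIntegral_mono_on ie (integrableOn_exp_neg_Ioi 0) measurableSet_Ioi fun t ht => ?_
    have hs : 0 ≤ Real.sinh t := Real.sinh_nonneg_iff.2 (le_of_lt ht)
    have : Real.exp (-x * Real.sinh t) ≤ 1 := Real.exp_le_one_iff.2 (by nlinarith)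
    exact mul_le_of_le_one_right (by positivity) this
  have hb0 : 0 ≤ ∫ t in Ioi (0:ℝ), Real.exp (-t) * Real.exp (-x * Real.sinh t) :=
    integral_nonneg fun t => by positivity
  have e : x * qq 1 x - 1 = -(x * ∫ t in Ioi (0:ℝ), Real.exp (-t) * Real.exp (-x * Real.sinh t)) := by
    simp only [qq]; linarith
  rw [e, abs_neg, abs_of_nonneg (by positivity)]
  nlinarith

lemma qq_zero_bound {x : ℝ} (hx : 0 < x) : |x * qq 0 x| ≤ 1 := by
  have hle : qq 0 x ≤ 1 / x := by
    have : ∫ t in Ioi (0:ℝ), Real.exp (-x * t) = 1 / x := by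
      rw [integral_exp_mul_Ioi (by linarith)]; simp
    rw [← this]
    refine setIntegral_mono_on (integrable_qq 0 hx) (exp_neg_integrableOn_Ioi 0 hx) measurableSet_Ioi
      fun t ht => ?_
    have h3 : t ≤ Real.sinh t := Real.self_le_sinh_iff.2 (le_of_lt ht)
    rw [pow_zero, one_mul]
    exact Real.exp_le_exp.2 (by nlinarith)
  have h0 : 0 ≤ qq 0 x := setIntegral_nonneg measurableSet_Ioi fun t ht => by
    rw [pow_zero]; positivity
  rw [abs_of_nonneg (by positivity)]
  rw [le_div_iff₀ hx] at hle
  linarith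

lemma besselJ_zero_eq (x : ℝ) : besselJ 0 x = cc 0 x / π := by
  simp [besselJ, cc]; ring

lemma besselJ_one_eq {x : ℝ} (hx : 0 < x) : besselJ 1 x = ss 1 x / π := by
  have h : ∫ τ in (0:ℝ)..π, (Real.cos (((1:ℕ):ℝ) * τ - x * Real.sin τ)
      - Real.sin τ ^ 1 * Real.sin (x * Real.sin τ)) = 0 := by
    rw [intervalIntegral.integral_eq_sub_of_hasDerivAt
      (f := fun τ => Real.sin (x * Real.sin τ) / x)]
    · simp
    · intro τ _
      refine ((((Real.hasDerivAt_sin τ).const_mul x).sin).div_const x).congr_deriv ?_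
      rw [Nat.cast_one, one_mul, Real.cos_sub]; field_simp; ring
    · exact Continuous.intervalIntegrable (by fun_prop) _ _
  rw [intervalIntegral.integral_sub] at h
  · rw [besselJ, sub_eq_zero.1 h, ss]; ring
  all_goals exact Continuous.intervalIntegrable (by fun_prop) _ _

lemma besselY_zero_eq (x : ℝ) : besselY 0 x = ss 0 x / π - 2 / π * qq 0 x := by
  have : ∀ t : ℝ, ((1:ℝ) + 1) * Real.exp (-x * Real.sinh t)
    = 2 * (Real.sinh t ^ 0 * Real.exp (-x * Real.sinh t)) := fun t => by ring
  simp only [besselY, ss, qq, Nat.cast_zero, zero_mul, sub_zero, Real.exp_zero, pow_zero, neg_zero,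
    mul_one]
  simp only [this]
  rw [MeasureTheory.integral_const_mul]
  simp only [pow_zero, one_mul]
  ring

lemma besselY_one_eq {x : ℝ} (hx : 0 < x) : besselY 1 x = -(cc 1 x / π) - 2 / π * qq 1 x := by
  have h : ∫ τ in (0:ℝ)..π, (Real.sin (x * Real.sin τ - ((1:ℕ):ℝ) * τ)
      + Real.sin τ ^ 1 * Real.cos (x * Real.sin τ)) = 0 := by
    rw [intervalIntegral.integral_eq_sub_of_hasDerivAt
      (f := fun τ => -(Real.cos (x * Real.sin τ) / x))]
    · simp
    · intro τ _
      refine ((((Real.hasDerivAt_sin τ).const_mul x).cos).div_const x).neg.congr_deriv ?_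
      rw [Nat.cast_one, one_mul, Real.sin_sub]; field_simp; ring
    · exact Continuous.intervalIntegrable (by fun_prop) _ _
  rw [intervalIntegral.integral_add] at h
  · have e : ∀ t : ℝ, (Real.exp (((1:ℕ):ℝ) * t) + (-1) ^ 1 * Real.exp (-(((1:ℕ):ℝ) * t)))
        * Real.exp (-x * Real.sinh t) = 2 * (Real.sinh t ^ 1 * Real.exp (-x * Real.sinh t)) := by
      intro t
      have : Real.sinh t = (Real.exp t - Real.exp (-t)) / 2 := Real.sinh_eq t
      rw [Nat.cast_one, one_mul, pow_one, pow_one]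
      linear_combination (-2 * Real.exp (-x * Real.sinh t)) * this
    rw [besselY]
    simp only [e]
    rw [eq_neg_of_add_eq_zero_left h, MeasureTheory.integral_const_mul, cc, qq]; ring
  all_goals exact Continuous.intervalIntegrable (by fun_prop) _ _

lemma half_int (φ : ℝ → ℝ) (hc : Continuous φ) (hs : ∀ τ, φ (π - τ) = φ τ) :
    ∫ τ in (0:ℝ)..π, φ τ = 2 * ∫ τ in (0:ℝ)..(π/2), φ τ := by
  have h1 := intervalIntegral.integral_add_adjacent_intervals (hc.intervalIntegrable (μ := volume) 0 (π/2))
    (hc.intervalIntegrable (π/2) π)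
  have h2 := intervalIntegral.integral_comp_sub_left φ π (a := 0) (b := π/2)
  simp only [hs, sub_zero] at h2
  rw [show π - π/2 = π/2 by ring] at h2
  linarith

lemma sin_image : Real.sin '' Ioo 0 (π/2) = Ioo 0 1 := by
  ext y
  constructor
  · rintro ⟨t, ⟨h0, h1⟩, rfl⟩
    refine ⟨Real.sin_pos_of_pos_of_lt_pi h0 (by linarith [Real.pi_pos]), ?_⟩
    rw [← Real.sin_pi_div_two]
    exact Real.sin_lt_sin_of_lt_of_le_pi_div_two (by linarith) le_rfl h1
  · rintro ⟨h0, h1⟩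
    exact ⟨Real.arcsin y, ⟨Real.arcsin_pos.2 h0, Real.arcsin_lt_pi_div_two.2 h1⟩,
      Real.sin_arcsin (by linarith) h1.le⟩

lemma sin_subst (g φ : ℝ → ℝ) (hc : Continuous φ) (hs : ∀ τ, φ (π - τ) = φ τ)
    (h : ∀ τ ∈ Ioo 0 (π/2), Real.cos τ * g (Real.sin τ) = φ τ) :
    2 * ∫ t in (0:ℝ)..1, g t = ∫ τ in (0:ℝ)..π, φ τ := by
  rw [half_int φ hc hs, intervalIntegral.integral_of_le zero_le_one,
    intervalIntegral.integral_of_le (by positivity), integral_Ioc_eq_integral_Ioo,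
    integral_Ioc_eq_integral_Ioo, ← sin_image,
    integral_image_eq_integral_abs_deriv_smul measurableSet_Ioo
      (fun t _ => (Real.hasDerivAt_sin t).hasDerivWithinAt)
      (Real.injOn_sin.mono (fun t ht => ⟨by linarith [ht.1, Real.pi_pos], ht.2.le⟩ :
        Ioo 0 (π/2) ⊆ Icc (-(π/2)) (π/2)))]
  congr 1
  refine setIntegral_congr_fun measurableSet_Ioo fun t ht => ?_
  have : 0 < Real.cos t := Real.cos_pos_of_mem_Ioo ⟨by linarith [ht.1, Real.pi_pos], ht.2⟩
  simp only [abs_of_pos this, smul_eq_mul]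
  exact h t ht

lemma struveH0_eq (x : ℝ) : struveH0 x = ss 0 x / π := by
  have := sin_subst (fun t => Real.sin (x * t) / Real.sqrt (1 - t ^ 2))
    (fun τ => Real.sin τ ^ 0 * Real.sin (x * Real.sin τ)) (by fun_prop) (by intro τ; simp)
    (by
      intro t ht
      have hc : 0 < Real.cos t := Real.cos_pos_of_mem_Ioo ⟨by linarith [ht.1, Real.pi_pos], ht.2⟩
      have : Real.sqrt (1 - Real.sin t ^ 2) = Real.cos t := by
        rw [← Real.cos_sq', Real.sqrt_sq hc.le]
      simp only [this]; field_simp)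
  rw [struveH0, ss, ← this]; ring

lemma struveH1_eq (x : ℝ) : struveH1 x = 2 / π - cc 1 x / π := by
  have := sin_subst (fun t => Real.sqrt (1 - t ^ 2) * Real.sin (x * t))
    (fun τ => Real.sin τ ^ 0 * Real.sin (x * Real.sin τ) - Real.sin τ ^ 2 * Real.sin (x * Real.sin τ))
    (by fun_prop) (by intro τ; simp)
    (by
      intro t ht
      have hc : 0 < Real.cos t := Real.cos_pos_of_mem_Ioo ⟨by linarith [ht.1, Real.pi_pos], ht.2⟩
      have : Real.sqrt (1 - Real.sin t ^ 2) = Real.cos t := by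
        rw [← Real.cos_sq', Real.sqrt_sq hc.le]
      simp only [this]; rw [Real.sin_sq t]; ring)
  rw [intervalIntegral.integral_sub (Continuous.intervalIntegrable (by fun_prop) _ _)
    (Continuous.intervalIntegrable (by fun_prop) _ _)] at this
  change _ = ss 0 x - ss 2 x at this
  have h2 := ss_rel x
  rw [← this] at h2
  rw [struveH1, ← sub_div, ← h2]; ring

lemma hankel0_eq (x : ℝ) : hankelH1 0 x
    = ((cc 0 x / π : ℝ) : ℂ) + Complex.I * ((ss 0 x / π - 2 / π * qq 0 x : ℝ) : ℂ) := by
  rw [hankelH1, besselJ_zero_eq, besselY_zero_eq]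

lemma hankel1_eq {x : ℝ} (hx : 0 < x) : hankelH1 1 x
    = ((ss 1 x / π : ℝ) : ℂ) + Complex.I * ((-(cc 1 x / π) - 2 / π * qq 1 x : ℝ) : ℂ) := by
  rw [hankelH1, besselJ_one_eq hx, besselY_one_eq hx]

lemma hasDerivAt_hankel0 {x : ℝ} (hx : 0 < x) : HasDerivAt (hankelH1 0) (-hankelH1 1 x) x := by
  have e : hankelH1 0 = fun x => ((cc 0 x / π : ℝ) : ℂ)
      + Complex.I * ((ss 0 x / π - 2 / π * qq 0 x : ℝ) : ℂ) := funext hankel0_eq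
  rw [e, hankel1_eq hx]
  have h1 := ((hasDerivAt_cc 0 x).div_const π).ofReal_comp
  have h2 := (((hasDerivAt_ss 0 x).div_const π).sub
    ((hasDerivAt_qq 0 hx).const_mul (2 / π))).ofReal_comp
  refine (h1.add (h2.const_mul Complex.I)).congr_deriv ?_
  push_cast; ring

lemma hasDerivAt_xhankel1 {x : ℝ} (hx : 0 < x) :
    HasDerivAt (fun x : ℝ => (x : ℂ) * hankelH1 1 x) ((x : ℂ) * hankelH1 0 x) x := by
  have e : (fun x : ℝ => (x : ℂ) * hankelH1 1 x) =ᶠ[𝓝 x] fun x => ((x * ss 1 x / π : ℝ) : ℂ)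
      + Complex.I * ((-(x * cc 1 x / π) - 2 / π * (x * qq 1 x) : ℝ) : ℂ) := by
    filter_upwards [Ioi_mem_nhds hx] with y hy
    rw [hankel1_eq hy]; push_cast; ring
  refine HasDerivAt.congr_of_eventuallyEq ?_ e
  have h1 : HasDerivAt (fun x => x * ss 1 x / π) (x * cc 0 x / π) x := by
    refine (((hasDerivAt_id x).mul (hasDerivAt_ss 1 x)).div_const π).congr_deriv ?_
    simp only [id, one_mul, Nat.reduceAdd, ← cc_rel x]; ring
  have h2 : HasDerivAt (fun x => x * cc 1 x / π) ((2 - x * ss 0 x) / π) x := by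
    refine (((hasDerivAt_id x).mul (hasDerivAt_cc 1 x)).div_const π).congr_deriv ?_
    have := ss_rel x
    simp only [id, one_mul, Nat.reduceAdd]
    congr 1; linarith
  have h3 : HasDerivAt (fun x => x * qq 1 x) (x * qq 0 x - 1) x := by
    refine (((hasDerivAt_id x).mul (hasDerivAt_qq 1 hx))).congr_deriv ?_
    have := qq_rel hx
    simp only [id, one_mul, Nat.reduceAdd]
    linarith
  refine (h1.ofReal_comp.add (((h2.neg).sub (h3.const_mul (2 / π))).ofReal_comp.const_mul
    Complex.I)).congr_deriv ?_
  rw [hankel0_eq]; push_cast; ring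

lemma continuous_cc (k : ℕ) : Continuous (cc k) :=
  continuous_iff_continuousAt.2 fun x => (hasDerivAt_cc k x).continuousAt

lemma continuous_ss (k : ℕ) : Continuous (ss k) :=
  continuous_iff_continuousAt.2 fun x => (hasDerivAt_ss k x).continuousAt

lemma cc_one_zero : cc 1 0 = 2 := by
  have := ss_rel 0
  linarith

lemma ss_zero (k : ℕ) : ss k 0 = 0 := by simp [ss]

lemma tendsto_xhankel1 :
    Tendsto (fun x : ℝ => (x : ℂ) * hankelH1 1 x) (𝓝[>] 0) (𝓝 (-((2 / π : ℝ) * Complex.I))) := by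
  have e : (fun x : ℝ => (x : ℂ) * hankelH1 1 x) =ᶠ[𝓝[>] 0] fun x => ((x * ss 1 x / π : ℝ) : ℂ)
      + Complex.I * ((-(x * cc 1 x / π) - 2 / π * (x * qq 1 x) : ℝ) : ℂ) := by
    filter_upwards [self_mem_nhdsWithin] with y hy
    rw [hankel1_eq hy]; push_cast; ring
  refine Tendsto.congr' e.symm ?_
  have h1 : Tendsto (fun x => x * ss 1 x / π) (𝓝[>] 0) (𝓝 0) := by
    have : Continuous (fun x => x * ss 1 x / π) := by
      have := continuous_ss 1
      fun_prop
    simpa using (this.tendsto 0).mono_left nhdsWithin_le_nhds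
  have h2 : Tendsto (fun x => x * cc 1 x / π) (𝓝[>] 0) (𝓝 0) := by
    have : Continuous (fun x => x * cc 1 x / π) := by
      have := continuous_cc 1
      fun_prop
    simpa using (this.tendsto 0).mono_left nhdsWithin_le_nhds
  have h3 : Tendsto (fun x => x * qq 1 x) (𝓝[>] 0) (𝓝 1) := by
    rw [tendsto_iff_norm_sub_tendsto_zero]
    refine squeeze_zero' (Eventually.of_forall fun t => norm_nonneg _) ?_
      ((continuous_id.tendsto (0:ℝ)).mono_left nhdsWithin_le_nhds)
    filter_upwards [self_mem_nhdsWithin] with y hy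
    exact qq_one_bound hy
  have h4 : Tendsto (fun x => -(x * cc 1 x / π) - 2 / π * (x * qq 1 x)) (𝓝[>] 0) (𝓝 (-(2/π))) := by
    simpa using h2.neg.sub (h3.const_mul (2 / π))
  have := ((Complex.continuous_ofReal.tendsto _).comp h1).add
    (((Complex.continuous_ofReal.tendsto _).comp h4).const_mul Complex.I)
  have hl : (-((2 / π : ℝ) * Complex.I) : ℂ) = ((0:ℝ) : ℂ) + Complex.I * ((-(2 / π) : ℝ) : ℂ) := by
    push_cast; ring
  rw [hl]
  exact this

lemma xhankel0_bound {x : ℝ} (hx : 0 < x) :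
    ‖(x : ℂ) * hankelH1 0 x‖ ≤ 2 * x + 1 := by
  have hp := Real.pi_pos
  have b1 : |cc 0 x| ≤ π := by
    have := intervalIntegral.norm_integral_le_of_norm_le_const (a := 0) (b := π) (C := 1)
      (f := fun τ => Real.sin τ ^ 0 * Real.cos (x * Real.sin τ))
      (fun t _ => sin_pow_abs_le _ _ _ (Real.abs_cos_le_one _))
    simpa [cc, abs_of_pos hp] using this
  have b2 : |ss 0 x| ≤ π := by
    have := intervalIntegral.norm_integral_le_of_norm_le_const (a := 0) (b := π) (C := 1)
      (f := fun τ => Real.sin τ ^ 0 * Real.sin (x * Real.sin τ))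
      (fun t _ => sin_pow_abs_le _ _ _ (Real.abs_sin_le_one _))
    simpa [ss, abs_of_pos hp] using this
  have b3 := qq_zero_bound hx
  have e : (x : ℂ) * hankelH1 0 x = ((x * (cc 0 x / π) : ℝ) : ℂ) + Complex.I * ((x * (ss 0 x / π) : ℝ) : ℂ)
      - Complex.I * ((2 / π * (x * qq 0 x) : ℝ) : ℂ) := by
    rw [hankel0_eq]; push_cast; ring
  rw [e]
  have c1 : |x * (cc 0 x / π)| ≤ x := by
    rw [abs_mul, abs_div, abs_of_pos hx, abs_of_pos hp]
    exact mul_le_of_le_one_right hx.le ((div_le_one hp).2 b1)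
  have c2 : |x * (ss 0 x / π)| ≤ x := by
    rw [abs_mul, abs_div, abs_of_pos hx, abs_of_pos hp]
    exact mul_le_of_le_one_right hx.le ((div_le_one hp).2 b2)
  have c3 : |2 / π * (x * qq 0 x)| ≤ 1 := by
    rw [abs_mul, abs_of_pos (by positivity : 0 < 2 / π)]
    exact mul_le_one₀ ((div_le_one hp).2 Real.two_le_pi) (abs_nonneg _) b3
  refine (norm_sub_le _ _).trans ?_
  refine (add_le_add_left (norm_add_le _ _) _).trans ?_
  rw [norm_mul, norm_mul, Complex.norm_I, one_mul, one_mul, Complex.norm_real, Complex.norm_real,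
    Complex.norm_real]
  simp only [Real.norm_eq_abs]
  linarith

lemma intervalIntegrable_xhankel0 {u : ℝ} (hu : 0 < u) :
    IntervalIntegrable (fun x : ℝ => (x : ℂ) * hankelH1 0 x) volume 0 u := by
  rw [intervalIntegrable_iff_integrableOn_Ioc_of_le hu.le]
  have hi : IntegrableOn (fun _ : ℝ => 2 * u + 1) (Ioc 0 u) := integrableOn_const (by simp)
  refine Integrable.mono' hi ?_ ?_
  · have hc : ContinuousOn (fun x : ℝ => (x : ℂ) * hankelH1 0 x) (Ioc 0 u) := fun x hx =>
      (Complex.continuous_ofReal.continuousAt.mul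
        (hasDerivAt_hankel0 hx.1).continuousAt).continuousWithinAt
    exact hc.aestronglyMeasurable measurableSet_Ioc
  · refine (ae_restrict_iff' measurableSet_Ioc).2 (Eventually.of_forall fun t ht => ?_)
    exact (xhankel0_bound ht.1).trans (by linarith [ht.2])

lemma calI1_eq {u : ℝ} (hu : 0 < u) :
    calI1 u = (u : ℂ) * hankelH1 1 u + (2 / π : ℝ) * Complex.I := by
  rw [calI1, intervalIntegral.integral_eq_sub_of_hasDerivAt_of_tendsto
    (f := fun x : ℝ => (x : ℂ) * hankelH1 1 x) hu
    (fun x hx => hasDerivAt_xhankel1 hx.1) (intervalIntegrable_xhankel0 hu) tendsto_xhankel1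
    ((hasDerivAt_xhankel1 hu).continuousAt.tendsto.mono_left nhdsWithin_le_nhds)]
  ring

lemma intervalIntegrable_calI1 {u : ℝ} (hu : 0 < u) :
    IntervalIntegrable calI1 volume 0 u := by
  apply ContinuousOn.intervalIntegrable
  exact intervalIntegral.continuousOn_primitive_interval
    (((intervalIntegrable_iff' enorm_ne_top).1 (intervalIntegrable_xhankel0 hu)))

noncomputable def FF (σ : ℝ) : ℂ := (π / 2 : ℝ) *
  (((σ : ℂ) * hankelH1 1 σ) * (struveH0 σ : ℂ) - hankelH1 0 σ * ((σ * struveH1 σ : ℝ) : ℂ))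
  + (2 * σ / π : ℝ) * Complex.I

lemma hasDerivAt_FF {x : ℝ} (hx : 0 < x) : HasDerivAt FF (calI1 x) x := by
  have hp := Real.pi_ne_zero
  have h0 : HasDerivAt struveH0 (2 / π - struveH1 x) x := by
    rw [show struveH0 = fun x => ss 0 x / π from funext struveH0_eq, struveH1_eq]
    refine ((hasDerivAt_ss 0 x).div_const π).congr_deriv ?_
    simp
  have h1 : HasDerivAt (fun x => x * struveH1 x) (x * struveH0 x) x := by
    simp only [struveH1_eq, struveH0_eq]
    refine ((hasDerivAt_id x).mul
      (((hasDerivAt_cc 1 x).div_const π).const_sub (2 / π))).congr_deriv ?_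
    have := ss_rel x
    simp only [id, one_mul, Nat.reduceAdd]
    field_simp; linarith
  have h2 : HasDerivAt (fun x : ℝ => 2 * x / π) (2 / π) x := by
    simpa using ((hasDerivAt_id x).const_mul 2).div_const π
  refine (((((hasDerivAt_xhankel1 hx).mul h0.ofReal_comp).sub
    ((hasDerivAt_hankel0 hx).mul h1.ofReal_comp)).const_mul ((π / 2 : ℝ) : ℂ)).add
    (h2.ofReal_comp.mul_const Complex.I)).congr_deriv ?_
  rw [calI1_eq hx]
  have hpc : (π : ℂ) ≠ 0 := by exact_mod_cast hp
  push_cast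
  field_simp
  ring

lemma tendsto_FF : Tendsto FF (𝓝[>] 0) (𝓝 0) := by
  have s0 : Tendsto struveH0 (𝓝[>] 0) (𝓝 0) := by
    rw [show struveH0 = fun x => ss 0 x / π from funext struveH0_eq]
    have : Continuous (fun x => ss 0 x / π) := (continuous_ss 0).div_const π
    simpa [ss_zero] using (this.tendsto 0).mono_left nhdsWithin_le_nhds
  have s1 : Tendsto struveH1 (𝓝[>] 0) (𝓝 0) := by
    rw [show struveH1 = fun x => 2 / π - cc 1 x / π from funext struveH1_eq]
    have : Continuous (fun x => 2 / π - cc 1 x / π) := continuous_const.sub ((continuous_cc 1).div_const π)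
    simpa [cc_one_zero] using (this.tendsto 0).mono_left nhdsWithin_le_nhds
  have a : Tendsto (fun σ : ℝ => ((σ : ℂ) * hankelH1 1 σ) * (struveH0 σ : ℂ)) (𝓝[>] 0) (𝓝 0) := by
    simpa using tendsto_xhankel1.mul ((Complex.continuous_ofReal.tendsto _).comp s0)
  have b : Tendsto (fun σ : ℝ => hankelH1 0 σ * ((σ * struveH1 σ : ℝ) : ℂ)) (𝓝[>] 0) (𝓝 0) := by
    rw [tendsto_zero_iff_norm_tendsto_zero]
    have hb : Tendsto (fun σ : ℝ => (2 * σ + 1) * |struveH1 σ|) (𝓝[>] 0) (𝓝 0) := by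
      have h : Tendsto (fun σ : ℝ => 2 * σ + 1) (𝓝[>] 0) (𝓝 1) := by
        have : Continuous (fun σ : ℝ => 2 * σ + 1) := by fun_prop
        simpa using (this.tendsto 0).mono_left nhdsWithin_le_nhds
      simpa using h.mul s1.abs
    refine squeeze_zero' (Eventually.of_forall fun t => norm_nonneg _) ?_ hb
    filter_upwards [self_mem_nhdsWithin] with y hy
    have : hankelH1 0 y * ((y * struveH1 y : ℝ) : ℂ) = ((y : ℂ) * hankelH1 0 y) * (struveH1 y : ℂ) := by
      push_cast; ring
    rw [this, norm_mul, Complex.norm_real, Real.norm_eq_abs]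
    exact mul_le_mul_of_nonneg_right (xhankel0_bound hy) (abs_nonneg _)
  have c : Tendsto (fun σ : ℝ => ((2 * σ / π : ℝ) : ℂ) * Complex.I) (𝓝[>] 0) (𝓝 0) := by
    have : Continuous (fun σ : ℝ => ((2 * σ / π : ℝ) : ℂ) * Complex.I) := by fun_prop
    simpa using (this.tendsto 0).mono_left nhdsWithin_le_nhds
  have := ((a.sub b).const_mul ((π / 2 : ℝ) : ℂ)).add c
  rw [sub_zero, mul_zero, add_zero] at this
  exact this

/-- `∫₀^σ 𝓘₁(x) dx = (πσ/2)·[H₁⁽¹⁾(σ)·𝐇₀(σ) − H₀⁽¹⁾(σ)·𝐇₁(σ)] + (2σ/π)·i`. -/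
theorem statement5 (σ : ℝ) (hσ : 0 < σ) :
    ∫ x in (0:ℝ)..σ, calI1 x
      = (π * σ / 2 : ℝ) *
          (hankelH1 1 σ * (struveH0 σ : ℂ) - hankelH1 0 σ * (struveH1 σ : ℂ))
        + (2 * σ / π : ℝ) * Complex.I := by
  rw [intervalIntegral.integral_eq_sub_of_hasDerivAt_of_tendsto (f := FF) hσ
    (fun x hx => hasDerivAt_FF hx.1) (intervalIntegrable_calI1 hσ) tendsto_FF
    ((hasDerivAt_FF hσ).continuousAt.tendsto.mono_left nhdsWithin_le_nhds), FF]
  push_cast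
  ring
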